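/- arXiv:1507.01564 — 3 statements merged into one kernel-verified Lean document; each statement's English description precedes it below -/
import Mathlib

section
/- Let I be a cofiltered category, F : I ⥤ J a functor and j an object of J. Let T be a finite connected partially ordered set, regarded as a category, and let G : T ⥤ (F/j) be any functor into the comma category F/j. Then there exist an object X of F/j and a natural transformation from the constant functor on T with value X to G. -/
open CategoryTheory

universe v₁ v₂ u₁ u₂

/-- If `I` is a cofiltered category, `F : I ⥤ J` a functor, `j : J`, `T` a finite connected
poset and `G : T ⥤ F/j` a functor into the comma category `F/j`, then there is an object `X`
of `F/j` and a natural transformation from the constant functor on `T` with value `X` to `G`. -/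
theorem exists_cone_over_finite_connected_poset_in_costructuredArrow
    {I : Type u₁} {J : Type u₂} [Category.{v₁} I] [Category.{v₂} J] [IsCofiltered I]
    (F : I ⥤ J) (j : J)
    (T : Type*) [PartialOrder T] [Fintype T] [IsConnected T]
    (G : T ⥤ CostructuredArrow F j) :
    ∃ X : CostructuredArrow F j, Nonempty ((Functor.const T).obj X ⟶ G) := by
  classical
  have : FinCategory T := { fintypeHom := fun a b => Fintype.ofFinite (a ⟶ b) }
  obtain ⟨c⟩ := IsCofiltered.cone_nonempty (G ⋙ CostructuredArrow.proj F j)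
  let p (t : T) : c.pt ⟶ (G.obj t).left := c.π.app t
  have hp {a b : T} (f : a ⟶ b) : p a ≫ (G.map f).left = p b := c.w f
  obtain ⟨α, hα⟩ := constant_of_preserves_morphisms'
    (fun t : T => F.map (p t) ≫ (G.obj t).hom) fun a b f => by
      rw [← hp f, F.map_comp, Category.assoc, CostructuredArrow.w]
  exact ⟨CostructuredArrow.mk α, ⟨{
    app := fun t => CostructuredArrow.homMk (p t) (hα t)
    naturality := fun a b f => CostructuredArrow.hom_ext _ _
      ((Category.id_comp (p b)).trans (hp f).symm) }⟩⟩
end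

section
/- For every small cofiltered category I there exist a partially ordered set T and a functor p : T ⥤ I, where T is regarded as a category with a unique morphism u → v whenever v ≤ u, such that: (i) T is directed (every two elements admit a common upper bound), so that the category T is cofiltered; (ii) T is cofinite, i.e., for every t ∈ T the set {s ∈ T | s < t} is finite; and (iii) p is initial, i.e., for every object i of I the comma category p/i (objects: pairs (t, p(t) → i)) is nonempty and connected. -/
open CategoryTheory

open Classical in
/-- A choice, for each finite subset `s` of a nonempty directed preorder, of an upper bound of `s`
that also lies above the bounds chosen for the proper subsets of `s`. -/
noncomputable def Finset.directedBound {α : Type*} [Nonempty α] [Preorder α] [IsDirectedOrder α]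
    (s : Finset α) : α :=
  (Finset.exists_le (s ∪ s.ssubsets.attach.image fun t => Finset.directedBound t.1)).choose
termination_by s.card
decreasing_by
  all_goals exact Finset.card_lt_card (Finset.mem_ssubsets.1 t.2)

section

variable {α : Type*} [Nonempty α] [Preorder α] [IsDirectedOrder α]

open Classical in
lemma Finset.le_directedBound_of_mem_union (s : Finset α) {a : α}
    (ha : a ∈ s ∪ s.ssubsets.attach.image fun t => Finset.directedBound t.1) :
    a ≤ s.directedBound := by
  rw [Finset.directedBound]
  exact Exists.choose_spec (Finset.exists_le _) a ha

lemma Finset.le_directedBound {s : Finset α} {a : α} (ha : a ∈ s) : a ≤ s.directedBound := by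
  classical
  exact s.le_directedBound_of_mem_union (Finset.mem_union_left _ ha)

lemma Finset.directedBound_mono : Monotone (Finset.directedBound (α := α)) := by
  classical
  intro s t hst
  obtain rfl | h := hst.eq_or_ssubset
  · exact le_rfl
  · exact t.le_directedBound_of_mem_union (Finset.mem_union_right _
      (Finset.mem_image.2 ⟨⟨s, Finset.mem_ssubsets.2 h⟩, Finset.mem_attach _ _, rfl⟩))

lemma Finset.final_directedBound_functor :
    (Finset.directedBound_mono (α := α)).functor.Final := by
  classical
  exact Finset.directedBound_mono.final_functor_iff.2 fun a =>
    ⟨{a}, Finset.le_directedBound (Finset.mem_singleton_self a)⟩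

end

/-- Every small cofiltered category `I` admits an initial functor `p : Tᵒᵖ ⥤ I` from (the
opposite of the order category of) a directed, cofinite partially ordered set `T`; here `Tᵒᵖ`
is exactly `T` regarded as a category with a unique morphism `u → v` whenever `v ≤ u`, and
directedness of `T` means that this category is cofiltered. -/
theorem exists_cofinite_inverse_poset_initial_functor
    {I : Type} [SmallCategory I] [IsCofiltered I] :
    ∃ (T : Type) (_ : PartialOrder T) (p : Tᵒᵖ ⥤ I),
      IsDirected T (· ≤ ·) ∧ (∀ t : T, {s : T | s < t}.Finite) ∧ p.Initial := by
  classical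
  obtain ⟨α, _, _, _, F, _⟩ := IsFiltered.exists_directed Iᵒᵖ
  have := Finset.final_directedBound_functor (α := α)
  exact ⟨Finset α, inferInstance, (Finset.directedBound_mono.functor ⋙ F).leftOp,
    inferInstance, fun t => Set.finite_Iio t, inferInstance⟩
end

section
/- Let (C, W, Fib) be a weak fibration category and let X be an object of C. Let W^fib_{X/} denote the category whose objects are morphisms w : X → Y belonging to W with Y fibrant, and whose morphisms (Y, w) → (Y', w') are morphisms φ : Y → Y' belonging to W with φ ∘ w = w'. Then for every finite poset T (regarded as a category) and every functor f : T ⥤ W^fib_{X/}, there exist a functor f' : T ⥤ W^fib_{X/}, an object (Y₀, v) of W^fib_{X/}, a natural transformation f ⟹ f', and a natural transformation from the constant functor on T with value (Y₀, v) to f'. In particular, the category W^fib_{X/} is nonempty, and any two of its objects are connected by a zig-zag of morphisms. -/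
open CategoryTheory Limits

universe v u

/-- A weak fibration category structure on a category `C` with all finite limits: classes
`W` (weak equivalences) and `Fib` (fibrations) containing all isomorphisms and closed under
composition, such that `W` has the two-out-of-three property, `Fib` and `Fib ⊓ W` are
closed under base change, and every morphism factors as a map in `W` followed by a map in
`Fib`. -/
structure WeakFibrationStructure (D : Type u) [Category.{v} D] [HasFiniteLimits D] where
  W : MorphismProperty D
  Fib : MorphismProperty D
  W_isos : MorphismProperty.isomorphisms D ≤ W
  Fib_isos : MorphismProperty.isomorphisms D ≤ Fib
  W_two_out_of_three : W.HasTwoOutOfThreeProperty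
  Fib_comp : Fib.IsStableUnderComposition
  Fib_base_change : Fib.IsStableUnderBaseChange
  trivFib_base_change : (Fib ⊓ W).IsStableUnderBaseChange
  factorization : ∀ ⦃A B : D⦄ (f : A ⟶ B), ∃ (E : D) (w : A ⟶ E) (p : E ⟶ B),
    W w ∧ Fib p ∧ w ≫ p = f

variable {C : Type u} [Category.{v} C] [HasFiniteLimits C]

/-- An object of the category `W^fib_{X/}`: a weak equivalence `w : X → Y` with `Y` fibrant
(i.e. the map from `Y` to the terminal object is a fibration). -/
structure FibrantReplacement (S : WeakFibrationStructure C) (X : C) where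
  obj : C
  w : X ⟶ obj
  w_mem : S.W w
  fibrant : S.Fib (terminal.from obj)

/-- The category structure on `W^fib_{X/}`: morphisms `(Y, w) → (Y', w')` are weak
equivalences `φ : Y → Y'` with `w ≫ φ = w'`. -/
instance fibrantReplacementCategory (S : WeakFibrationStructure C) (X : C) :
    Category (FibrantReplacement S X) where
  Hom A B := { φ : A.obj ⟶ B.obj // S.W φ ∧ A.w ≫ φ = B.w }
  id A := ⟨𝟙 A.obj, S.W_isos _ (MorphismProperty.isomorphisms.infer_property _),
    Category.comp_id _⟩
  comp {A B D} φ ψ := ⟨φ.1 ≫ ψ.1,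
    S.W_two_out_of_three.toIsStableUnderComposition.comp_mem φ.1 ψ.1 φ.2.1 ψ.2.1,
    by rw [← Category.assoc, φ.2.2, ψ.2.2]⟩
  id_comp φ := by apply Subtype.ext; simp
  comp_id φ := by apply Subtype.ext; simp
  assoc := by intros; apply Subtype.ext; simp

namespace WeakFibrationStructure

variable (S : WeakFibrationStructure C)

lemma fib_of_isIso {A B : C} (f : A ⟶ B) [IsIso f] : S.Fib f :=
  S.Fib_isos _ (MorphismProperty.isomorphisms.infer_property _)

lemma w_of_isIso {A B : C} (f : A ⟶ B) [IsIso f] : S.W f :=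
  S.W_isos _ (MorphismProperty.isomorphisms.infer_property _)

lemma w_right {A B D : C} {f : A ⟶ B} {g : B ⟶ D} (hf : S.W f) (hfg : S.W (f ≫ g)) : S.W g :=
  S.W_two_out_of_three.toHasOfPrecompProperty.of_precomp f g hf hfg

lemma w_left {A B D : C} {f : A ⟶ B} {g : B ⟶ D} (hg : S.W g) (hfg : S.W (f ≫ g)) : S.W f :=
  S.W_two_out_of_three.toHasOfPostcompProperty.of_postcomp f g hg hfg

lemma w_comp {A B D : C} {f : A ⟶ B} {g : B ⟶ D} (hf : S.W f) (hg : S.W g) : S.W (f ≫ g) :=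
  S.W_two_out_of_three.toIsStableUnderComposition.comp_mem f g hf hg

lemma fib_of_isPullback {P A B D : C} {fst : P ⟶ A} {snd : P ⟶ B} {f : A ⟶ D} {g : B ⟶ D}
    (sq : IsPullback fst snd f g) (hg : S.Fib g) : S.Fib fst :=
  S.Fib_base_change.of_isPullback sq.flip hg

/-- The source of a fibration with fibrant target is fibrant. -/
lemma fibrant_of_fib {A B : C} {p : A ⟶ B} (hp : S.Fib p) (hB : S.Fib (terminal.from B)) :
    S.Fib (terminal.from A) := by
  rw [← terminal.comp_from p]
  exact S.Fib_comp.comp_mem _ _ hp hB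

lemma fibrant_terminal : S.Fib (terminal.from (⊤_ C)) := by
  rw [show terminal.from (⊤_ C) = 𝟙 _ from Subsingleton.elim _ _]
  exact S.fib_of_isIso _

lemma fibrant_prod {A B : C} (hA : S.Fib (terminal.from A)) (hB : S.Fib (terminal.from B)) :
    S.Fib (terminal.from (A ⨯ B)) :=
  S.fibrant_of_fib
    (S.fib_of_isPullback (IsPullback.of_isLimit_binaryFan_of_isTerminal
      (prodIsProd A B) terminalIsTerminal) hB) hA

end WeakFibrationStructure

/-- A product indexed by an empty type admits a unique map from every object, so any map
between two such products is an isomorphism. -/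
lemma isIso_of_isEmpty_index {ι : Type} [IsEmpty ι] {A B : ι → C}
    (f : ∏ᶜ A ⟶ ∏ᶜ B) : IsIso f :=
  ⟨Pi.lift isEmptyElim, Pi.hom_ext _ _ isEmptyElim, Pi.hom_ext _ _ isEmptyElim⟩

lemma isIso_pi_π {D : Type*} [Category* D] {ι : Type*} [Unique ι] (A : ι → D) (i : ι) :
    IsIso (Pi.π A i) := by
  obtain rfl := Unique.eq_default i
  rw [← productUniqueIso_hom]
  infer_instance

/-- Fibrations are stable under powers indexed by a type with at most one element. -/
lemma WeakFibrationStructure.fib_pi_lift_of_subsingleton (S : WeakFibrationStructure C)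
    {ι : Type} [Finite ι] [Subsingleton ι] {A B : C} {p : A ⟶ B} (hp : S.Fib p) :
    S.Fib (Pi.lift fun i : ι => Pi.π (fun _ => A) i ≫ p) := by
  rcases isEmpty_or_nonempty ι with h | ⟨⟨i⟩⟩
  · have := isIso_of_isEmpty_index (Pi.lift fun i : ι => Pi.π (fun _ => A) i ≫ p)
    exact S.fib_of_isIso _
  · let : Unique ι := ⟨⟨i⟩, fun _ => Subsingleton.elim _ _⟩
    have := isIso_pi_π (fun _ : ι => A) i
    have := isIso_pi_π (fun _ : ι => B) i
    exact S.fib_of_isPullback (IsPullback.of_vert_isIso ⟨Pi.lift_π _ i⟩) hp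

/-- The transpose of `φ : F.obj t ⟶ A` under the adjunction between evaluation at `t` and its
right adjoint. -/
noncomputable def toEvaluationRightAdjoint {P : Type} [PartialOrder P] (F : P ⥤ C) {t : P}
    {A : C} (φ : F.obj t ⟶ A) : F ⟶ (evaluationRightAdjoint C t).obj A where
  app s := Pi.lift fun g : s ⟶ t => F.map g ≫ φ
  naturality s s' h := Pi.hom_ext _ _ fun g => by
    simp [evaluationRightAdjoint]

/-- One step of the Reedy fibrant replacement: factoring `α.app t` and pulling back along the
right Kan extension of the resulting fibration yields a replacement at `t` that changes
nothing, up to isomorphism, at the objects not below `t`. -/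
lemma WeakFibrationStructure.exists_factorization_at (S : WeakFibrationStructure C)
    {P : Type} [PartialOrder P] {f F : P ⥤ C} (α : f ⟶ F) (t : P) :
    ∃ (G : P ⥤ C) (β : f ⟶ G) (q : G ⟶ F), β ≫ q = α ∧ (∀ s, S.Fib (q.app s)) ∧
      S.W (β.app t) ∧ ∀ s, ¬ s ≤ t → IsIso (q.app s) := by
  obtain ⟨E, w, p, hw, hp, hwp⟩ := S.factorization (α.app t)
  let η := toEvaluationRightAdjoint F (𝟙 (F.obj t))
  let θ := toEvaluationRightAdjoint f w
  let ρ := (evaluationRightAdjoint C t).map p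
  have comm : α ≫ η = θ ≫ ρ := by
    ext s
    refine Pi.hom_ext _ _ fun g => ?_
    simp [η, θ, ρ, toEvaluationRightAdjoint, evaluationRightAdjoint, hwp]
  have sq (s : P) : IsPullback ((pullback.fst η ρ).app s) ((pullback.snd η ρ).app s)
      (η.app s) (ρ.app s) :=
    (IsPullback.of_hasPullback _ _).map ((evaluation P C).obj s)
  refine ⟨_, pullback.lift α θ comm, pullback.fst η ρ, pullback.lift_fst _ _ _,
    fun s => S.fib_of_isPullback (sq s) (S.fib_pi_lift_of_subsingleton hp), ?_, fun s hs => ?_⟩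
  · let : Unique (t ⟶ t) := ⟨⟨𝟙 t⟩, fun _ => Subsingleton.elim _ _⟩
    let π (A : C) : ((evaluationRightAdjoint C t).obj A).obj t ⟶ A :=
      Pi.π (fun _ : t ⟶ t => A) (𝟙 t)
    have hπ (A : C) : IsIso (π A) := isIso_pi_π (fun _ : t ⟶ t => A) (𝟙 t)
    have hη : η.app t ≫ π (F.obj t) = 𝟙 _ :=
      (Pi.lift_π _ _).trans (by simp)
    have hθ : θ.app t ≫ π E = w :=
      (Pi.lift_π _ _).trans (by simp)
    have : IsIso (η.app t) := IsIso.of_isIso_fac_right hη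
    have := (sq t).isIso_snd_of_isIso
    refine S.w_left (S.w_of_isIso ((pullback.snd η ρ).app t ≫ π E)) ?_
    rwa [← Category.assoc, ← NatTrans.comp_app, pullback.lift_snd, hθ]
  · have : IsEmpty (s ⟶ t) := ⟨fun g => hs (leOfHom g)⟩
    have : IsIso (ρ.app s) := isIso_of_isEmpty_index (ι := s ⟶ t) _
    exact (sq s).isIso_fst_of_isIso

/-- Every diagram indexed by a finite poset admits an objectwise weak equivalence to an
objectwise fibrant diagram. -/
lemma WeakFibrationStructure.exists_objectwise_fibrant_replacement
    (S : WeakFibrationStructure C) {P : Type} [PartialOrder P] [Finite P] (f : P ⥤ C) :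
    ∃ (F : P ⥤ C) (α : f ⟶ F), ∀ s, S.W (α.app s) ∧ S.Fib (terminal.from (F.obj s)) := by
  classical
  have key : ∀ U : Finset P, IsUpperSet (U : Set P) → ∃ (F : P ⥤ C) (α : f ⟶ F),
      (∀ s, S.Fib (terminal.from (F.obj s))) ∧ ∀ s ∈ U, S.W (α.app s) := by
    intro U
    induction U using Finset.strongInduction with
    | H U ih =>
      intro hU
      rcases U.eq_empty_or_nonempty with rfl | hne
      · exact ⟨(Functor.const P).obj (⊤_ C), { app := fun _ => terminal.from _ },
          fun _ => S.fibrant_terminal, by simp⟩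
      · obtain ⟨t, ht⟩ := U.exists_minimal hne
        obtain ⟨F, α, hF, hα⟩ := ih (U.erase t) (Finset.erase_ssubset ht.prop) (by
          intro a b hab ha
          simp only [Finset.coe_erase, Set.mem_sdiff, Set.mem_singleton_iff] at ha ⊢
          refine ⟨hU hab ha.1, ?_⟩
          rintro rfl
          exact ha.2 (ht.eq_of_le ha.1 hab))
        obtain ⟨G, β, q, rfl, hq, hβ, hiso⟩ := S.exists_factorization_at α t
        refine ⟨G, β, fun s => S.fibrant_of_fib (hq s) (hF s), fun s hs => ?_⟩
        by_cases hst : s = t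
        · rwa [hst]
        · have := hiso s fun hle => hst (ht.eq_of_le hs hle)
          exact S.w_left (S.w_of_isIso (q.app s)) (hα s (Finset.mem_erase.2 ⟨hst, hs⟩))
  have := Fintype.ofFinite P
  obtain ⟨F, α, hF, hα⟩ := key Finset.univ (by simpa using isUpperSet_univ)
  exact ⟨F, α, fun s => ⟨hα s (Finset.mem_univ s), hF s⟩⟩

namespace FibrantReplacement

variable {S : WeakFibrationStructure C} {X : C} {T : Type} [PartialOrder T]

/-- The diagram underlying `f`, extended by `X` at an added bottom element. -/
def extendBot (f : T ⥤ FibrantReplacement S X) : WithBot T ⥤ C where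
  obj
    | ⊥ => X
    | (t : T) => (f.obj t).obj
  map {a b} g := match a, b, g with
    | ⊥, ⊥, _ => 𝟙 X
    | ⊥, (t : T), _ => (f.obj t).w
    | (s : T), (t : T), g => (f.map (homOfLE (WithBot.coe_le_coe.1 (leOfHom g)))).1
    | (s : T), ⊥, g => (WithBot.not_coe_le_bot s (leOfHom g)).elim
  map_id a := by
    cases a with
    | bot => rfl
    | coe t => exact congrArg Subtype.val (f.map_id t)
  map_comp {a b c} g h := by
    cases a with
    | bot =>
      cases b with
      | bot => cases c <;> exact (Category.id_comp _).symm
      | coe s =>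
        cases c with
        | bot => exact (WithBot.not_coe_le_bot s (leOfHom h)).elim
        | coe t => exact (f.map (homOfLE (WithBot.coe_le_coe.1 (leOfHom h)))).2.2.symm
    | coe r =>
      cases b with
      | bot => exact (WithBot.not_coe_le_bot r (leOfHom g)).elim
      | coe s =>
        cases c with
        | bot => exact (WithBot.not_coe_le_bot s (leOfHom h)).elim
        | coe t =>
          exact congrArg Subtype.val (f.map_comp (homOfLE (WithBot.coe_le_coe.1 (leOfHom g)))
            (homOfLE (WithBot.coe_le_coe.1 (leOfHom h))))

lemma exists_cospan [Finite T] (f : T ⥤ FibrantReplacement S X) :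
    ∃ (f' : T ⥤ FibrantReplacement S X) (Y₀ : FibrantReplacement S X),
      Nonempty (f ⟶ f') ∧ Nonempty ((Functor.const T).obj Y₀ ⟶ f') := by
  have : Finite (WithBot T) := inferInstanceAs (Finite (Option T))
  obtain ⟨F, α, h⟩ := S.exists_objectwise_fibrant_replacement (extendBot f)
  let ι {s t : T} (g : s ⟶ t) : (s : WithBot T) ⟶ t := homOfLE (WithBot.coe_le_coe.2 (leOfHom g))
  let b (t : T) : (⊥ : WithBot T) ⟶ t := homOfLE bot_le
  have nat (t : T) : (f.obj t).w ≫ α.app (t : WithBot T) = α.app ⊥ ≫ F.map (b t) :=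
    α.naturality (b t)
  have nat' {s t : T} (g : s ⟶ t) :
      (f.map g).1 ≫ α.app (t : WithBot T) = α.app (s : WithBot T) ≫ F.map (ι g) :=
    α.naturality (ι g)
  have hb (t : T) : S.W (F.map (b t)) :=
    S.w_right (h ⊥).1 (nat t ▸ S.w_comp (f.obj t).w_mem (h t).1)
  have hbι {s t : T} (g : s ⟶ t) : F.map (b s) ≫ F.map (ι g) = F.map (b t) := by
    rw [← F.map_comp]
    rfl
  let Y₀ : FibrantReplacement S X := ⟨F.obj ⊥, α.app ⊥, (h ⊥).1, (h ⊥).2⟩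
  let f' : T ⥤ FibrantReplacement S X :=
    { obj := fun t => ⟨F.obj t, α.app ⊥ ≫ F.map (b t), S.w_comp (h ⊥).1 (hb t), (h t).2⟩
      map := fun {s t} g => ⟨F.map (ι g), S.w_right (hb s) ((hbι g).symm ▸ hb t),
        (Category.assoc _ _ _).trans (congrArg (α.app ⊥ ≫ ·) (hbι g))⟩
      map_id := fun t => Subtype.ext (F.map_id _)
      map_comp := fun g g' => Subtype.ext (F.map_comp (ι g) (ι g')) }
  exact ⟨f', Y₀,
    ⟨{ app := fun t => ⟨α.app (t : WithBot T), (h t).1, nat t⟩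
       naturality := fun _ _ g => Subtype.ext (nat' g) }⟩,
    ⟨{ app := fun t => ⟨F.map (b t), hb t, rfl⟩
       naturality := fun _ _ g => Subtype.ext ((Category.id_comp _).trans (hbι g).symm) }⟩⟩

lemma exists_span (A B : FibrantReplacement S X) :
    ∃ E : FibrantReplacement S X, Nonempty (E ⟶ A) ∧ Nonempty (E ⟶ B) := by
  obtain ⟨E, w, p, hw, hp, hwp⟩ := S.factorization (prod.lift A.w B.w)
  have hA : w ≫ p ≫ prod.fst = A.w := by rw [← Category.assoc, hwp, prod.lift_fst]
  have hB : w ≫ p ≫ prod.snd = B.w := by rw [← Category.assoc, hwp, prod.lift_snd]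
  exact ⟨⟨E, w, hw, S.fibrant_of_fib hp (S.fibrant_prod A.fibrant B.fibrant)⟩,
    ⟨⟨p ≫ prod.fst, S.w_right hw (hA.symm ▸ A.w_mem), hA⟩⟩,
    ⟨⟨p ≫ prod.snd, S.w_right hw (hB.symm ▸ B.w_mem), hB⟩⟩⟩

instance : Nonempty (FibrantReplacement S X) := by
  obtain ⟨E, w, p, hw, hp, -⟩ := S.factorization (terminal.from X)
  exact ⟨⟨E, w, hw, S.fibrant_of_fib hp S.fibrant_terminal⟩⟩

instance : IsConnected (FibrantReplacement S X) :=
  zigzag_isConnected fun A B => by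
    obtain ⟨E, ⟨a⟩, ⟨b⟩⟩ := exists_span A B
    exact (Zigzag.of_inv a).trans (Zigzag.of_hom b)

end FibrantReplacement

/-- For a weak fibration category `(C, W, Fib)` and an object `X`, every functor from a
finite poset `T` to the category `W^fib_{X/}` of fibrant replacements of `X` admits a
natural transformation to a functor `f'` which itself receives a natural transformation
from a constant functor.  In particular `W^fib_{X/}` is nonempty and connected. -/
theorem fibrantReplacement_cone_zigzag (S : WeakFibrationStructure C) (X : C)
    {T : Type} [PartialOrder T] [Fintype T]
    (f : T ⥤ FibrantReplacement S X) :
    (∃ (f' : T ⥤ FibrantReplacement S X) (Y₀ : FibrantReplacement S X),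
      Nonempty (f ⟶ f') ∧ Nonempty ((Functor.const T).obj Y₀ ⟶ f')) ∧
    IsConnected (FibrantReplacement S X) := by
  exact ⟨FibrantReplacement.exists_cospan f, inferInstance⟩
end
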